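/- arXiv:1210.2490 — 7 statements merged into one kernel-verified Lean document; each statement's English description precedes it below -/
import Mathlib

section
/- Let K be a field with a field automorphism τ, and let ϑ ∈ K satisfy τ^k(ϑ) ≠ ϑ for all k ≥ 1. Then the operators E_k form a τ-linear higher derivation: for all x, y ∈ K and all k ≥ 0, E_k(x·y) = Σ_{i+j=k} E_i(x)·τ^i(E_j(y)). -/
/-- The operators `E_k` of the generalized Carlitz module attached to a
difference field `(K, τ)` and an element `ϑ`. -/
noncomputable def carlitzE {K : Type*} [Field K] (τ : RingAut K) (ϑ : K) : ℕ → K → K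
  | 0, z => z
  | k + 1, z =>
      (τ (carlitzE τ ϑ k z) - carlitzE τ ϑ k z) / ((τ ^ (k + 1)) ϑ - ϑ)

theorem carlitzE_tau {K : Type*} [Field K] (τ : RingAut K) (ϑ : K)
    (hϑ : ∀ k : ℕ, 1 ≤ k → (τ ^ k) ϑ ≠ ϑ) (z : K) (k : ℕ) :
    τ (carlitzE τ ϑ k z) =
      carlitzE τ ϑ k z + ((τ ^ (k + 1)) ϑ - ϑ) * carlitzE τ ϑ (k + 1) z := by
  have h : (τ ^ (k + 1)) ϑ - ϑ ≠ 0 := sub_ne_zero.mpr (hϑ (k + 1) (by omega))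
  rw [carlitzE, mul_div_cancel₀ _ h]
  ring

/-- The operators `E_k` form a `τ`-linear higher derivation:
`E_k(x·y) = Σ_{i+j=k} E_i(x)·τ^i(E_j(y))`. -/
theorem carlitzE_mul {K : Type*} [Field K] (τ : RingAut K) (ϑ : K)
    (hϑ : ∀ k : ℕ, 1 ≤ k → (τ ^ k) ϑ ≠ ϑ) (x y : K) (k : ℕ) :
    carlitzE τ ϑ k (x * y) =
      ∑ i ∈ Finset.range (k + 1), carlitzE τ ϑ i x * (τ ^ i) (carlitzE τ ϑ (k - i) y) := by
  induction k with
  | zero => simp [carlitzE]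
  | succ k ih =>
    have h : (τ ^ (k + 1)) ϑ - ϑ ≠ 0 := sub_ne_zero.mpr (hϑ (k + 1) (by omega))
    rw [carlitzE, div_eq_iff h, ih, map_sum, ← Finset.sum_sub_distrib]
    have key : ∀ i ∈ Finset.range (k + 1),
        τ (carlitzE τ ϑ i x * (τ ^ i) (carlitzE τ ϑ (k - i) y)) -
          carlitzE τ ϑ i x * (τ ^ i) (carlitzE τ ϑ (k - i) y) =
        ((τ ^ (i + 1)) ϑ - ϑ) * (carlitzE τ ϑ (i + 1) x *
          (τ ^ (i + 1)) (carlitzE τ ϑ (k + 1 - (i + 1)) y)) +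
        ((τ ^ (k + 1)) ϑ - (τ ^ i) ϑ) * (carlitzE τ ϑ i x *
          (τ ^ i) (carlitzE τ ϑ (k + 1 - i) y)) := by
      intro i hi
      have hi' : i ≤ k := Nat.lt_succ_iff.mp (Finset.mem_range.mp hi)
      obtain ⟨j, rfl⟩ := Nat.exists_eq_add_of_le hi'
      have e1 : i + j - i = j := by omega
      have e2 : i + j + 1 - (i + 1) = j := by omega
      have e3 : i + j + 1 - i = j + 1 := by omega
      rw [e1, e2, e3, map_mul, carlitzE_tau τ ϑ hϑ x i]
      have c1 : τ ((τ ^ i) (carlitzE τ ϑ j y)) = (τ ^ (i + 1)) (carlitzE τ ϑ j y) := by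
        rw [pow_succ']; rfl
      have c2 : (τ ^ (i + 1)) (carlitzE τ ϑ j y) = (τ ^ i) (carlitzE τ ϑ j y) +
          ((τ ^ (i + j + 1)) ϑ - (τ ^ i) ϑ) * (τ ^ i) (carlitzE τ ϑ (j + 1) y) := by
        have c3 : (τ ^ (i + 1)) (carlitzE τ ϑ j y) = (τ ^ i) (τ (carlitzE τ ϑ j y)) := by
          rw [pow_succ]; rfl
        have c4 : (τ ^ (i + j + 1)) ϑ = (τ ^ i) ((τ ^ (j + 1)) ϑ) := by
          rw [add_assoc, pow_add]; rfl
        rw [c3, carlitzE_tau τ ϑ hϑ y j, map_add, map_mul, map_sub, c4]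
      rw [c1]
      linear_combination carlitzE τ ϑ i x * c2
    rw [Finset.sum_congr rfl key, Finset.sum_add_distrib]
    have s1 := Finset.sum_range_succ' (fun i => ((τ ^ i) ϑ - ϑ) * (carlitzE τ ϑ i x *
          (τ ^ i) (carlitzE τ ϑ (k + 1 - i) y))) (k + 1)
    have s2 := Finset.sum_range_succ (fun i => ((τ ^ (k + 1)) ϑ - (τ ^ i) ϑ) *
          (carlitzE τ ϑ i x * (τ ^ i) (carlitzE τ ϑ (k + 1 - i) y))) (k + 1)
    have z : (τ ^ 0) ϑ - ϑ = 0 := by simp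
    simp only [z, zero_mul, add_zero] at s1
    simp only [sub_self, zero_mul, add_zero] at s2
    rw [← s1, ← s2, ← Finset.sum_add_distrib, Finset.sum_mul]
    exact Finset.sum_congr rfl fun i _ => by ring
end

section
/- Let K be a field with a field automorphism τ, let K^per = {c ∈ K : τ^n(c) = c for some n ≥ 1} be its field of periodic points, and let ϑ ∈ K be transcendental over K^per. Then for a ∈ K, one has E_k(a) = 0 for all sufficiently large k if and only if a belongs to the subring K^τ[ϑ] of polynomial expressions in ϑ with coefficients in the fixed field K^τ. -/
theorem cE_succ {K : Type*} [Field K] (τ : RingAut K) (ϑ : K)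
    (hn : ∀ k : ℕ, (τ ^ (k + 1)) ϑ - ϑ ≠ 0) (k : ℕ) (z : K) :
    carlitzE τ ϑ (k + 1) z * ((τ ^ (k + 1)) ϑ - ϑ) =
      τ (carlitzE τ ϑ k z) - carlitzE τ ϑ k z := by
  rw [carlitzE, div_mul_cancel₀ _ (hn k)]

theorem cE_add {K : Type*} [Field K] (τ : RingAut K) (ϑ : K) (k : ℕ) (x y : K) :
    carlitzE τ ϑ k (x + y) = carlitzE τ ϑ k x + carlitzE τ ϑ k y := by
  induction k with
  | zero => simp [carlitzE]
  | succ k ih => simp only [carlitzE, ih, map_add]; ring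

theorem cE_smul {K : Type*} [Field K] (τ : RingAut K) (ϑ c : K) (hc : τ c = c) (k : ℕ) (x : K) :
    carlitzE τ ϑ k (c * x) = c * carlitzE τ ϑ k x := by
  induction k with
  | zero => simp [carlitzE]
  | succ k ih => simp only [carlitzE, ih, map_mul, hc]; ring

theorem cE_zero {K : Type*} [Field K] (τ : RingAut K) (ϑ : K) (k : ℕ) :
    carlitzE τ ϑ k 0 = 0 := by
  simpa using cE_smul τ ϑ 0 (map_zero τ) k 0

theorem cE_mono {K : Type*} [Field K] (τ : RingAut K) (ϑ : K) (z : K) (k m : ℕ) (hkm : k ≤ m)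
    (h : carlitzE τ ϑ k z = 0) : carlitzE τ ϑ m z = 0 := by
  induction m, hkm using Nat.le_induction with
  | base => exact h
  | succ m _ ih => simp [carlitzE, ih]

theorem cE_mul {K : Type*} [Field K] (τ : RingAut K) (ϑ : K)
    (hn : ∀ k : ℕ, (τ ^ (k + 1)) ϑ - ϑ ≠ 0) (z : K) (k : ℕ) :
    carlitzE τ ϑ (k + 1) (ϑ * z) =
      (τ ^ (k + 1)) ϑ * carlitzE τ ϑ (k + 1) z + carlitzE τ ϑ k z := by
  induction k with
  | zero =>
    apply mul_right_cancel₀ (hn 0)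
    have h1 := cE_succ τ ϑ hn 0 (ϑ * z)
    have h2 := cE_succ τ ϑ hn 0 z
    simp only [carlitzE, map_mul, zero_add, pow_one] at h1 h2 ⊢
    linear_combination h1 - τ ϑ * h2
  | succ k ih =>
    apply mul_right_cancel₀ (hn (k + 1))
    have h1 := cE_succ τ ϑ hn (k + 1) (ϑ * z)
    have h2 := cE_succ τ ϑ hn (k + 1) z
    have h3 := cE_succ τ ϑ hn k z
    have h4 : τ ((τ ^ (k + 1)) ϑ) = (τ ^ (k + 1 + 1)) ϑ := by
      rw [pow_succ' τ (k + 1)]; rfl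
    rw [ih, map_add, map_mul, h4] at h1
    linear_combination h1 - (τ ^ (k + 1 + 1)) ϑ * h2 - h3

theorem cE_pow {K : Type*} [Field K] (τ : RingAut K) (ϑ : K)
    (hn : ∀ k : ℕ, (τ ^ (k + 1)) ϑ - ϑ ≠ 0) (k : ℕ) :
    carlitzE τ ϑ k (ϑ ^ k) = 1 ∧ carlitzE τ ϑ (k + 1) (ϑ ^ k) = 0 := by
  induction k with
  | zero => simp [carlitzE]
  | succ k ih =>
    have h0 := cE_mono τ ϑ (ϑ ^ k) (k + 1) (k + 1 + 1) (by omega) ih.2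
    rw [pow_succ', cE_mul τ ϑ hn, cE_mul τ ϑ hn, ih.1, ih.2, h0]
    simp

theorem cE_exists {K : Type*} [Field K] (τ : RingAut K) (ϑ : K)
    (hn : ∀ k : ℕ, (τ ^ (k + 1)) ϑ - ϑ ≠ 0) (k : ℕ) (a : K) (h : carlitzE τ ϑ k a = 0) :
    ∃ p : Polynomial K, (∀ i : ℕ, τ (p.coeff i) = p.coeff i) ∧ Polynomial.eval ϑ p = a := by
  induction k generalizing a with
  | zero => exact ⟨0, by simp, by simpa [carlitzE] using h.symm⟩
  | succ k ih =>
    have hc := cE_succ τ ϑ hn k a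
    rw [h, zero_mul] at hc
    set c := carlitzE τ ϑ k a with hcd
    have hc' : τ c = c := (sub_eq_zero.mp hc.symm)
    have hm : τ (-c) = -c := by rw [map_neg, hc']
    obtain ⟨p, hp, hpe⟩ := ih (a + (-c) * ϑ ^ k) (by
      rw [cE_add, cE_smul τ ϑ _ hm, (cE_pow τ ϑ hn k).1, ← hcd]; ring)
    refine ⟨p + Polynomial.C c * Polynomial.X ^ k, fun i => ?_, ?_⟩
    · rw [Polynomial.coeff_add, Polynomial.coeff_C_mul_X_pow, map_add, hp]
      split_ifs <;> simp [hc']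
    · simp [hpe]

/-- Suppose `ϑ` is transcendental over the field of periodic points `K^per`
(expressed as: no nonzero polynomial with coefficients periodic under `τ`
vanishes at `ϑ`).  Then `E_k(a) = 0` for all sufficiently large `k` if and only
if `a` lies in the subring `K^τ[ϑ]`, i.e. `a` is a polynomial expression in `ϑ`
with coefficients in the fixed field of `τ`. -/
theorem carlitzE_eventually_zero_iff {K : Type*} [Field K] (τ : RingAut K) (ϑ : K)
    (hϑ : ∀ p : Polynomial K, (∀ i : ℕ, ∃ n : ℕ, 1 ≤ n ∧ (τ ^ n) (p.coeff i) = p.coeff i) →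
      Polynomial.eval ϑ p = 0 → p = 0)
    (a : K) :
    (∃ N : ℕ, ∀ k : ℕ, N ≤ k → carlitzE τ ϑ k a = 0) ↔
      ∃ p : Polynomial K, (∀ i : ℕ, τ (p.coeff i) = p.coeff i) ∧ Polynomial.eval ϑ p = a := by
  have hn : ∀ k : ℕ, (τ ^ (k + 1)) ϑ - ϑ ≠ 0 := by
    intro k hk
    have hk' := sub_eq_zero.mp hk
    refine Polynomial.X_sub_C_ne_zero ϑ (hϑ _ (fun i => ⟨k + 1, by omega, ?_⟩) (by simp))
    rw [Polynomial.coeff_sub, Polynomial.coeff_X, Polynomial.coeff_C, map_sub]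
    split_ifs <;> simp [hk']
  constructor
  · rintro ⟨N, hN⟩
    exact cE_exists τ ϑ hn N a (hN N le_rfl)
  · rintro ⟨p, hp, rfl⟩
    refine ⟨p.natDegree + 1, fun k hk => ?_⟩
    rw [Polynomial.eval_eq_sum_range]
    refine Finset.sum_induction _ (fun z => carlitzE τ ϑ k z = 0) ?_ (cE_zero τ ϑ k) ?_
    · intro x y hx hy
      rw [cE_add, hx, hy, add_zero]
    · intro i hi
      rw [Finset.mem_range] at hi
      rw [cE_smul τ ϑ _ (hp i), cE_mono τ ϑ _ (i + 1) k (by omega) (cE_pow τ ϑ hn i).2, mul_zero]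
end

section
/- Let K be a field with a field automorphism τ and ϑ ∈ K. Suppose (x_i)_{i≥1} is a ϑ-coherent sequence in K, that is: x_1 ≠ 0, ϑ·x_1 − τ(x_1) = 0, and ϑ·x_i − τ(x_i) = x_{i-1} for all i ≥ 2. Then the elements x_1, x_2, x_3, … are linearly independent over the fixed field K^τ. -/
/-- The coefficients of a ϑ-coherent sequence, i.e. a sequence `(x_i)_{i≥1}` with
`x_1 ≠ 0`, `ϑ·x_1 − τ(x_1) = 0` and `ϑ·x_i − τ(x_i) = x_{i-1}` for `i ≥ 2`, are
linearly independent over the fixed field `K^τ`. -/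
theorem coherent_linearIndependent {K : Type*} [Field K] (τ : RingAut K) (ϑ : K)
    (x : ℕ → K) (hx1 : x 1 ≠ 0) (h1 : ϑ * x 1 - τ (x 1) = 0)
    (hcoh : ∀ i : ℕ, 2 ≤ i → ϑ * x i - τ (x i) = x (i - 1)) :
    ∀ (m : ℕ) (c : ℕ → K), (∀ i, τ (c i) = c i) →
      (∑ i ∈ Finset.range m, c i * x (i + 1)) = 0 → ∀ i < m, c i = 0 := by
  intro m
  induction m with
  | zero => intro c _ _ i hi; omega
  | succ m ih =>
    intro c hc hs
    have hshift : (∑ i ∈ Finset.range m, c (i + 1) * x (i + 1)) = 0 := by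
      have h2 : ϑ * (∑ i ∈ Finset.range (m + 1), c i * x (i + 1))
          - τ (∑ i ∈ Finset.range (m + 1), c i * x (i + 1)) = 0 := by
        rw [hs]; simp
      rw [map_sum, Finset.mul_sum, ← Finset.sum_sub_distrib, Finset.sum_range_succ'] at h2
      have h0 : ϑ * (c 0 * x (0 + 1)) - τ (c 0 * x (0 + 1)) = 0 := by
        rw [map_mul, hc, zero_add]
        linear_combination c 0 * h1
      rw [h0, add_zero] at h2
      rw [← h2]
      refine Finset.sum_congr rfl fun i _ => ?_
      have h3 := hcoh (i + 1 + 1) (by omega)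
      rw [Nat.add_sub_cancel] at h3
      rw [map_mul, hc]
      linear_combination (-c (i + 1)) * h3
    have hz := ih (fun i => c (i + 1)) (fun i => hc (i + 1)) hshift
    rw [Finset.sum_range_succ', Finset.sum_eq_zero, zero_add, zero_add] at hs
    · intro i hi
      cases i with
      | zero => exact (mul_eq_zero.mp hs).resolve_right hx1
      | succ i => exact hz i (by omega)
    · intro i hi
      have h4 : c (i + 1) = 0 := hz i (Finset.mem_range.mp hi)
      rw [h4, zero_mul]
end

section
/- Let K be a field with a field automorphism τ and let ϑ ∈ K satisfy τ^n(ϑ) ≠ ϑ for all n ≥ 1. Define sequences (d_n), (l_n) in K by d_0 = l_0 = 1, d_n = (ϑ − τ^n(ϑ))·τ(d_{n-1}) and l_n = (τ^n(ϑ) − ϑ)·l_{n-1} for n ≥ 1 (all d_n, l_n are then nonzero). Then for every k ≥ 1, Σ_{i=0}^{k} d_i^{-1}·τ^i(l_{k-i}^{-1}) = 0 and Σ_{i=0}^{k} l_i^{-1}·τ^i(d_{k-i}^{-1}) = 0. (Equivalently, the formal series E = Σ_n d_n^{-1} τ^n and L = Σ_n l_n^{-1} τ^n in the skew power series ring K[[τ]]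 are mutually inverse.) -/
/-- The denominators `d_n` of the Carlitz exponential series attached to `(K, τ, ϑ)`:
`d_0 = 1`, `d_n = (ϑ − τ^n(ϑ))·τ(d_{n-1})`. -/
noncomputable def carlitzD {K : Type*} [Field K] (τ : RingAut K) (ϑ : K) : ℕ → K
  | 0 => 1
  | n + 1 => (ϑ - (τ ^ (n + 1)) ϑ) * τ (carlitzD τ ϑ n)

/-- The denominators `l_n` of the Carlitz logarithm series attached to `(K, τ, ϑ)`:
`l_0 = 1`, `l_n = (τ^n(ϑ) − ϑ)·l_{n-1}`. -/
noncomputable def carlitzL {K : Type*} [Field K] (τ : RingAut K) (ϑ : K) : ℕ → K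
  | 0 => 1
  | n + 1 => ((τ ^ (n + 1)) ϑ - ϑ) * carlitzL τ ϑ n

theorem carlitz_split {K : Type*} [Field K] (τ : RingAut K) (ϑ : K) (k : ℕ) (t : ℕ → K) :
    ((τ ^ (k + 1)) ϑ - ϑ) * ∑ i ∈ Finset.range (k + 2), t i =
      ∑ i ∈ Finset.range (k + 1), ((τ ^ (k + 1)) ϑ - (τ ^ i) ϑ) * t i +
      ∑ i ∈ Finset.range (k + 1), ((τ ^ (i + 1)) ϑ - ϑ) * t (i + 1) := by
  have h1 : ∑ i ∈ Finset.range (k + 2), ((τ ^ (k + 1)) ϑ - (τ ^ i) ϑ) * t i =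
      ∑ i ∈ Finset.range (k + 1), ((τ ^ (k + 1)) ϑ - (τ ^ i) ϑ) * t i := by
    rw [Finset.sum_range_succ]; simp
  have h2 : ∑ i ∈ Finset.range (k + 2), ((τ ^ i) ϑ - ϑ) * t i =
      ∑ i ∈ Finset.range (k + 1), ((τ ^ (i + 1)) ϑ - ϑ) * t (i + 1) := by
    rw [Finset.sum_range_succ']; simp
  rw [← h1, ← h2, ← Finset.sum_add_distrib, Finset.mul_sum]
  exact Finset.sum_congr rfl fun i _ => by ring

theorem carlitz_inv_aux {K : Type*} [Field K] {x y : K} (h : x ≠ 0) : x * (x * y)⁻¹ = y⁻¹ := by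
  rw [mul_inv, ← mul_assoc, mul_inv_cancel₀ h, one_mul]

theorem carlitz_first_step {K : Type*} [Field K] (τ : RingAut K) (ϑ : K)
    (hϑ : ∀ n : ℕ, 1 ≤ n → (τ ^ n) ϑ ≠ ϑ) (k : ℕ) :
    ((τ ^ (k + 1)) ϑ - ϑ) * (∑ i ∈ Finset.range (k + 2),
      (carlitzD τ ϑ i)⁻¹ * (τ ^ i) ((carlitzL τ ϑ (k + 1 - i))⁻¹)) =
    (∑ i ∈ Finset.range (k + 1), (carlitzD τ ϑ i)⁻¹ * (τ ^ i) ((carlitzL τ ϑ (k - i))⁻¹)) -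
    τ (∑ i ∈ Finset.range (k + 1),
      (carlitzD τ ϑ i)⁻¹ * (τ ^ i) ((carlitzL τ ϑ (k - i))⁻¹)) := by
  rw [carlitz_split, sub_eq_add_neg, map_sum, ← Finset.sum_neg_distrib]
  congr 1
  · refine Finset.sum_congr rfl fun i hi => ?_
    obtain ⟨m, rfl⟩ := Nat.exists_eq_add_of_le (Nat.lt_succ_iff.mp (Finset.mem_range.mp hi))
    have e1 : i + m + 1 - i = m + 1 := by omega
    have e2 : i + m - i = m := by omega
    have e3 : (τ ^ (i + m + 1)) ϑ - (τ ^ i) ϑ = (τ ^ i) ((τ ^ (m + 1)) ϑ - ϑ) := by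
      rw [map_sub, ← RingAut.mul_apply, ← pow_add, add_assoc]
    rw [e1, e2, e3, mul_left_comm, ← map_mul, carlitzL,
      carlitz_inv_aux (sub_ne_zero.mpr (hϑ _ (by omega)))]
  · refine Finset.sum_congr rfl fun i hi => ?_
    have e1 : k + 1 - (i + 1) = k - i := by omega
    have hne : ϑ - (τ ^ (i + 1)) ϑ ≠ 0 := sub_ne_zero.mpr (hϑ _ (by omega)).symm
    rw [e1, ← neg_sub ϑ, neg_mul, ← mul_assoc, carlitzD, carlitz_inv_aux hne, map_mul,
      map_inv₀ τ, pow_succ' τ i, RingAut.mul_apply]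

theorem carlitz_second_step {K : Type*} [Field K] (τ : RingAut K) (ϑ : K)
    (hϑ : ∀ n : ℕ, 1 ≤ n → (τ ^ n) ϑ ≠ ϑ) (k : ℕ) :
    ((τ ^ (k + 1)) ϑ - ϑ) * (∑ i ∈ Finset.range (k + 2),
      (carlitzL τ ϑ i)⁻¹ * (τ ^ i) ((carlitzD τ ϑ (k + 1 - i))⁻¹)) = 0 := by
  rw [carlitz_split, ← Finset.sum_add_distrib]
  refine Finset.sum_eq_zero fun i hi => ?_
  obtain ⟨m, rfl⟩ := Nat.exists_eq_add_of_le (Nat.lt_succ_iff.mp (Finset.mem_range.mp hi))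
  have e1 : i + m + 1 - i = m + 1 := by omega
  have e2 : i + m + 1 - (i + 1) = m := by omega
  have e3 : (τ ^ (i + m + 1)) ϑ - (τ ^ i) ϑ = -(τ ^ i) (ϑ - (τ ^ (m + 1)) ϑ) := by
    rw [map_sub, ← RingAut.mul_apply, ← pow_add, add_assoc, neg_sub]
  have hne : ϑ - (τ ^ (m + 1)) ϑ ≠ 0 := sub_ne_zero.mpr (hϑ _ (by omega)).symm
  have hne' : (τ ^ (i + 1)) ϑ - ϑ ≠ 0 := sub_ne_zero.mpr (hϑ _ (by omega))
  rw [e1, e2, e3, neg_mul, mul_left_comm, ← map_mul, carlitzD, carlitz_inv_aux hne,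
    ← mul_assoc, carlitzL, carlitz_inv_aux hne', pow_succ τ i, RingAut.mul_apply, map_inv₀ τ]
  exact neg_add_cancel _

theorem carlitz_first {K : Type*} [Field K] (τ : RingAut K) (ϑ : K)
    (hϑ : ∀ n : ℕ, 1 ≤ n → (τ ^ n) ϑ ≠ ϑ) (k : ℕ) :
    (∑ i ∈ Finset.range (k + 2),
      (carlitzD τ ϑ i)⁻¹ * (τ ^ i) ((carlitzL τ ϑ (k + 1 - i))⁻¹)) = 0 := by
  have hne : (τ ^ (k + 1)) ϑ - ϑ ≠ 0 := sub_ne_zero.mpr (hϑ _ (by omega))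
  refine (mul_eq_zero.mp ?_).resolve_left hne
  rw [carlitz_first_step τ ϑ hϑ k]
  cases k with
  | zero => simp [carlitzD, carlitzL]
  | succ k => rw [carlitz_first τ ϑ hϑ k]; simp

/-- The exponential series `E = Σ d_n⁻¹ τ^n` and logarithm series `L = Σ l_n⁻¹ τ^n`
are mutually inverse in the skew power series ring `K[[τ]]`: for every `k ≥ 1`,
`Σ_{i=0}^{k} d_i⁻¹·τ^i(l_{k-i}⁻¹) = 0` and `Σ_{i=0}^{k} l_i⁻¹·τ^i(d_{k-i}⁻¹) = 0`. -/
theorem carlitz_exp_log_inverse {K : Type*} [Field K] (τ : RingAut K) (ϑ : K)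
    (hϑ : ∀ n : ℕ, 1 ≤ n → (τ ^ n) ϑ ≠ ϑ) (k : ℕ) (hk : 1 ≤ k) :
    (∑ i ∈ Finset.range (k + 1), (carlitzD τ ϑ i)⁻¹ * (τ ^ i) ((carlitzL τ ϑ (k - i))⁻¹)) = 0 ∧
    (∑ i ∈ Finset.range (k + 1), (carlitzL τ ϑ i)⁻¹ * (τ ^ i) ((carlitzD τ ϑ (k - i))⁻¹)) = 0 := by
  obtain ⟨k, rfl⟩ := Nat.exists_eq_add_of_le' hk
  refine ⟨carlitz_first τ ϑ hϑ k, ?_⟩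
  have hne : (τ ^ (k + 1)) ϑ - ϑ ≠ 0 := sub_ne_zero.mpr (hϑ _ (by omega))
  exact (mul_eq_zero.mp (carlitz_second_step τ ϑ hϑ k)).resolve_left hne
end

section
/- Let f be a polynomial with complex coefficients of degree d, let Δ be the forward difference operator on polynomials, (Δg)(s) = g(s+1) − g(s), and let Δ^k denote its k-th iterate. Then for all s, x ∈ ℂ such that s − x is not a nonpositive integer, Σ_{k=0}^{d} (−1)^k ((Δ^k f)(s)/k!) · Γ(s + k − x) = f(x) · Γ(s − x). (All arguments s+k−x, k ≥ 0, are then automatically not nonpositive integers.) -/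
open Polynomial

/-- The forward difference operator on complex polynomials: `(Δg)(s) = g(s+1) − g(s)`. -/
noncomputable def polyFwdDiff (g : Polynomial ℂ) : Polynomial ℂ :=
  g.comp (Polynomial.X + Polynomial.C 1) - g

lemma polyFwdDiff_iter_eval (f : Polynomial ℂ) (k : ℕ) (y : ℂ) :
    (polyFwdDiff^[k] f).eval y = (fwdDiff (1 : ℂ))^[k] (fun z => f.eval z) y := by
  induction k generalizing f with
  | zero => simp
  | succ k ih =>
    rw [Function.iterate_succ_apply, Function.iterate_succ_apply, ih]
    have h : (fun z => (polyFwdDiff f).eval z) = fwdDiff (1 : ℂ) (fun z => f.eval z) := by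
      funext z
      simp [polyFwdDiff, fwdDiff]
    rw [h]

lemma newton_nat (f : Polynomial ℂ) (s : ℂ) (n : ℕ) :
    ∑ k ∈ Finset.range (f.natDegree + 1),
      (n.choose k : ℂ) * (polyFwdDiff^[k] f).eval s = f.eval (s + n) := by
  have h := shift_eq_sum_fwdDiff_iter (1 : ℂ) (fun z => f.eval z) n s
  simp only [nsmul_eq_mul, mul_one] at h
  rw [h]
  simp only [← polyFwdDiff_iter_eval]
  have h1 : Finset.range (f.natDegree + 1) ⊆ Finset.range (f.natDegree + n + 1) :=
    Finset.range_mono (by omega)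
  have h2 : Finset.range (n + 1) ⊆ Finset.range (f.natDegree + n + 1) :=
    Finset.range_mono (by omega)
  rw [Finset.sum_subset h1, Finset.sum_subset h2]
  · intro k _ hk
    rw [Nat.choose_eq_zero_of_lt (by simpa using hk)]
    simp
  · intro k _ hk
    rw [polyFwdDiff_iter_eval]
    have hk' : f.natDegree < k := by simpa using hk
    have := congrFun (Polynomial.fwdDiff_iter_eq_zero_of_degree_lt hk') s
    simp only [Pi.zero_apply] at this
    erw [this]
    simp

lemma newton_poly (f : Polynomial ℂ) (s x : ℂ) :
    ∑ k ∈ Finset.range (f.natDegree + 1),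
      (-1) ^ k * ((polyFwdDiff^[k] f).eval s / (k.factorial : ℂ)) *
        (ascPochhammer ℂ k).eval (s - x) = f.eval x := by
  have key : (∑ k ∈ Finset.range (f.natDegree + 1),
      C ((-1) ^ k * ((polyFwdDiff^[k] f).eval s / (k.factorial : ℂ))) *
        (ascPochhammer ℂ k).comp (C s - X)) = f := by
    apply Polynomial.eq_of_infinite_eval_eq
    apply Set.Infinite.mono (s := Set.range (fun n : ℕ => s + (n : ℂ)))
    · rintro _ ⟨n, rfl⟩
      simp only [Set.mem_ofPred_eq, eval_finsetSum, eval_mul, eval_C, eval_comp, eval_sub, eval_X]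
      rw [← newton_nat]
      refine Finset.sum_congr rfl fun k _ => ?_
      rw [show s - (s + (n : ℂ)) = -(n : ℂ) by ring, ascPochhammer_eval_neg_eq_descPochhammer,
        descPochhammer_eval_eq_descFactorial, Nat.descFactorial_eq_factorial_mul_choose]
      have hk : (k.factorial : ℂ) ≠ 0 := by exact_mod_cast k.factorial_ne_zero
      have h1 : ((-1 : ℂ) ^ k) * (-1) ^ k = 1 := by rw [← mul_pow]; simp
      push_cast
      field_simp
      linear_combination ((n.choose k : ℂ) * (polyFwdDiff^[k] f).eval s) * h1
    · exact Set.infinite_range_of_injective fun a b h => by simpa using h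
  have := congrArg (eval x) key
  simpa only [eval_finsetSum, eval_mul, eval_C, eval_comp, eval_sub, eval_X] using this

lemma gamma_shift (z : ℂ) (hz : ∀ m : ℕ, z ≠ -(m : ℂ)) (k : ℕ) :
    Complex.Gamma (z + k) = (ascPochhammer ℂ k).eval z * Complex.Gamma z := by
  induction k with
  | zero => simp
  | succ k ih =>
    have : z + k ≠ 0 := fun h => hz k (eq_neg_of_add_eq_zero_left h)
    rw [Nat.cast_succ, ← add_assoc, Complex.Gamma_add_one _ this, ih, ascPochhammer_succ_eval]
    ring

/-- `Γ(s−t)` is an eigenfunction of the Carlitz operator `φ(f)` with eigenvalue `f(x)`: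
for a complex polynomial `f` of degree `d`,
`Σ_{k=0}^{d} (−1)^k (Δ^k f)(s)/k! · Γ(s+k−x) = f(x)·Γ(s−x)`
whenever `s − x` is not a nonpositive integer. -/
theorem carlitz_eigen_gamma (f : Polynomial ℂ) (d : ℕ) (hd : f.natDegree = d)
    (s x : ℂ) (hsx : ∀ m : ℕ, s - x ≠ -(m : ℂ)) :
    ∑ k ∈ Finset.range (d + 1),
        (-1) ^ k * ((polyFwdDiff^[k] f).eval s / (k.factorial : ℂ)) *
          Complex.Gamma (s + k - x) =
      f.eval x * Complex.Gamma (s - x) := by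
  subst hd
  rw [← newton_poly f s x, Finset.sum_mul]
  refine Finset.sum_congr rfl fun k _ => ?_
  rw [show s + (k : ℂ) - x = s - x + k by ring, gamma_shift _ hsx]
  ring
end

section
/- Let s ∈ ℂ with Re(s) > 0. Then, as z → 1 through the half-plane {z : Re(z) > 1}, the function z ↦ (Σ_{n≥0} (n+s)^{−z}) − 1/(z−1) tends to the limit −Γ'(s)/Γ(s), where Γ' is the derivative of the complex Gamma function. (Here (n+s)^{−z} is defined via the principal branch of the complex power; the Hurwitz zeta series converges for Re(z) > 1.) -/
open Filter

/-- The comparison terms whose exponentiated sum is a Gamma product. -/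
noncomputable def hzG (n : ℕ) (w : ℂ) : ℂ :=
  Complex.log ((n : ℂ) + 1) - Complex.log ((n : ℂ) + w) + (w - 1) / ((n : ℂ) + 1)

lemma hz_lower {c : ℝ} (hc1 : c ≤ 1) (n : ℕ) {w : ℂ} (hw : (n : ℝ) + c ≤ w.re) :
    c * ((n : ℝ) + 1) ≤ ‖w‖ := by
  have h1 := Complex.re_le_norm w
  have h2 : (0 : ℝ) ≤ n := Nat.cast_nonneg n
  nlinarith

lemma hz_summable (K : ℝ) : Summable (fun n : ℕ => K * (((n : ℝ) + 1) ^ 2)⁻¹) := by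
  have h := (summable_nat_add_iff 1).2 ((Real.summable_nat_pow_inv (p := 2)).2 (by norm_num))
  refine Summable.mul_left K (h.congr fun n => ?_)
  push_cast
  rfl

lemma hz_term_bound {c : ℝ} (hc : 0 < c) (hc1 : c ≤ 1) (n : ℕ) {w : ℂ} (hw : c ≤ w.re) :
    ‖1 / ((n : ℂ) + 1) - 1 / ((n : ℂ) + w)‖ ≤ ‖w - 1‖ / c * (((n : ℝ) + 1) ^ 2)⁻¹ := by
  have hl : c * ((n : ℝ) + 1) ≤ ‖(n : ℂ) + w‖ := hz_lower hc1 n (by simpa using hw)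
  have hn : (0 : ℝ) < (n : ℝ) + 1 := by positivity
  have hpos : 0 < ‖(n : ℂ) + w‖ := lt_of_lt_of_le (by positivity) hl
  have h0 : (n : ℂ) + w ≠ 0 := norm_pos_iff.1 hpos
  have h1 : (n : ℂ) + 1 ≠ 0 := by exact_mod_cast Nat.succ_ne_zero n
  have e : 1 / ((n : ℂ) + 1) - 1 / ((n : ℂ) + w) = (w - 1) / (((n : ℂ) + 1) * ((n : ℂ) + w)) := by
    field_simp
    ring
  have e2 : ‖(n : ℂ) + 1‖ = (n : ℝ) + 1 := by
    have : (n : ℂ) + 1 = ((n + 1 : ℕ) : ℂ) := by push_cast; rfl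
    rw [this, Complex.norm_natCast]; push_cast; rfl
  rw [e, norm_div, norm_mul, e2]
  have : ‖w - 1‖ / c * (((n : ℝ) + 1) ^ 2)⁻¹ = ‖w - 1‖ / (((n : ℝ) + 1) * (c * ((n : ℝ) + 1))) := by
    field_simp
  rw [this]
  gcongr

lemma hzG_hasDerivAt (n : ℕ) {w : ℂ} (hw : 0 < w.re) :
    HasDerivAt (hzG n) (1 / ((n : ℂ) + 1) - 1 / ((n : ℂ) + w)) w := by
  have hsl : (n : ℂ) + w ∈ Complex.slitPlane := by
    left
    have : (0 : ℝ) ≤ n := Nat.cast_nonneg n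
    simp
    linarith
  have h1 : HasDerivAt (fun w : ℂ => (n : ℂ) + w) 1 w := (hasDerivAt_id w).const_add _
  have h2 := h1.clog hsl
  have h3 : HasDerivAt (fun w : ℂ => (w - 1) / ((n : ℂ) + 1)) (1 / ((n : ℂ) + 1)) w :=
    ((hasDerivAt_id w).sub_const 1).div_const _
  have h4 := (h2.const_sub (Complex.log ((n : ℂ) + 1))).add h3
  convert! h4 using 1
  ring

lemma hzG_main (s : ℂ) (hs : 0 < s.re) :
    (HasDerivAt (fun w => ∑' n, hzG n w) (∑' n : ℕ, (1 / ((n : ℂ) + 1) - 1 / ((n : ℂ) + s))) s) ∧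
      Summable (fun n => hzG n s) := by
  obtain ⟨c, hc, hc1, hcs⟩ : ∃ c : ℝ, 0 < c ∧ c < 1 ∧ c < s.re := by
    obtain ⟨c, h1, h2⟩ := exists_between (lt_min one_pos hs)
    exact ⟨c, h1, (lt_min_iff.1 h2).1, (lt_min_iff.1 h2).2⟩
  set t : Set ℂ := {w | c < w.re} ∩ Metric.ball 1 (‖s - 1‖ + 1) with ht
  have hto : IsOpen t := (isOpen_lt continuous_const Complex.continuous_re).inter Metric.isOpen_ball
  have htc : IsPreconnected t :=
    ((convex_halfSpace_re_gt c).inter (convex_ball _ _)).isPreconnected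
  have h1t : (1 : ℂ) ∈ t := ⟨by simpa using hc1, by simp; positivity⟩
  have hst : s ∈ t := ⟨hcs, by simp [dist_eq_norm]⟩
  have hg : ∀ (n : ℕ) (y : ℂ), y ∈ t →
      HasDerivAt (hzG n) (1 / ((n : ℂ) + 1) - 1 / ((n : ℂ) + y)) y :=
    fun n y hy => hzG_hasDerivAt n (hc.trans hy.1)
  have hb : ∀ (n : ℕ) (y : ℂ), y ∈ t → ‖1 / ((n : ℂ) + 1) - 1 / ((n : ℂ) + y)‖ ≤
      (‖s - 1‖ + 1) / c * (((n : ℝ) + 1) ^ 2)⁻¹ := by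
    intro n y hy
    refine (hz_term_bound hc hc1.le n (le_of_lt hy.1)).trans ?_
    have : ‖y - 1‖ ≤ ‖s - 1‖ + 1 := by
      have := hy.2
      rw [Metric.mem_ball, dist_eq_norm] at this
      exact this.le
    gcongr
  have h0 : Summable (fun n => hzG n 1) := by
    have : (fun n => hzG n 1) = fun _ => 0 := by
      funext n
      simp [hzG]
    rw [this]
    exact summable_zero
  exact ⟨hasDerivAt_tsum_of_isPreconnected (hz_summable _) hto htc hg hb h1t h0 hst,
    summable_of_summable_hasDerivAt_of_isPreconnected (hz_summable _) hto htc hg hb h1t h0 hst⟩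

lemma hzG_partial (s : ℂ) (hs : 0 < s.re) (N : ℕ) (hN : N ≠ 0) :
    Complex.exp (∑ n ∈ Finset.range (N + 1), hzG n s) =
      Complex.GammaSeq s N * (1 + 1 / (N : ℂ)) *
        Complex.exp ((s - 1) * (((harmonic N : ℝ) - Real.log N + 1 / ((N : ℝ) + 1) : ℝ) : ℂ)) := by
  have hprod : ∀ M : ℕ, Complex.exp (∑ n ∈ Finset.range M, hzG n s) =
      (M.factorial : ℂ) / (∏ j ∈ Finset.range M, (s + j)) *
        Complex.exp ((s - 1) * ((harmonic M : ℝ) : ℂ)) := by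
    intro M
    induction M with
    | zero => simp
    | succ M ih =>
      have h0 : (M : ℂ) + s ≠ 0 := by
        intro h
        have := congrArg Complex.re h
        have h2 : (0 : ℝ) ≤ M := Nat.cast_nonneg M
        simp at this
        linarith
      have h1 : (M : ℂ) + 1 ≠ 0 := by exact_mod_cast Nat.succ_ne_zero M
      rw [Finset.sum_range_succ, Complex.exp_add, ih, Finset.prod_range_succ, harmonic_succ,
        Nat.factorial_succ, hzG, Complex.exp_add, Complex.exp_sub, Complex.exp_log h0,
        Complex.exp_log h1]
      have : (s - 1) * (((harmonic M + ((M + 1 : ℕ) : ℚ)⁻¹ : ℚ) : ℝ) : ℂ) =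
          (s - 1) * ((harmonic M : ℝ) : ℂ) + (s - 1) / ((M : ℂ) + 1) := by
        push_cast
        ring
      rw [this, Complex.exp_add, add_comm s]
      push_cast
      field_simp
  have hNc : (N : ℂ) ≠ 0 := by exact_mod_cast hN
  have hlog : Complex.log (N : ℂ) = ((Real.log N : ℝ) : ℂ) := by
    rw [Complex.ofReal_log (Nat.cast_nonneg N)]
    simp
  rw [hprod, Complex.GammaSeq, harmonic_succ, Complex.cpow_def_of_ne_zero hNc, hlog]
  have e1 : (s - 1) * (((harmonic N + ((N + 1 : ℕ) : ℚ)⁻¹ : ℚ) : ℝ) : ℂ) =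
      (s - 1) * (((harmonic N : ℝ) - Real.log N + 1 / ((N : ℝ) + 1) : ℝ) : ℂ) +
        ((Real.log N : ℝ) : ℂ) * s - Complex.log (N : ℂ) := by
    rw [hlog]
    push_cast
    ring
  rw [e1, Complex.exp_sub, Complex.exp_add, Complex.exp_log hNc, Nat.factorial_succ]
  push_cast
  field_simp

lemma hzG_exp (s : ℂ) (hs : 0 < s.re) :
    Complex.exp (∑' n, hzG n s) =
      Complex.Gamma s * Complex.exp ((s - 1) * (Real.eulerMascheroniConstant : ℂ)) := by
  have h1 : Tendsto (fun N : ℕ => Complex.exp (∑ n ∈ Finset.range (N + 1), hzG n s)) atTop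
      (nhds (Complex.exp (∑' n, hzG n s))) :=
    (Complex.continuous_exp.tendsto _).comp
      (((hzG_main s hs).2.hasSum.tendsto_sum_nat).comp (tendsto_add_atTop_nat 1))
  have h2 : Tendsto (fun N : ℕ => Complex.GammaSeq s N * (1 + 1 / (N : ℂ)) *
        Complex.exp ((s - 1) * (((harmonic N : ℝ) - Real.log N + 1 / ((N : ℝ) + 1) : ℝ) : ℂ)))
      atTop (nhds (Complex.Gamma s * (1 + 0) *
        Complex.exp ((s - 1) * ((Real.eulerMascheroniConstant + 0 : ℝ) : ℂ)))) := by
    refine ((Complex.GammaSeq_tendsto_Gamma s).mul (tendsto_const_nhds.add ?_)).mul ?_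
    · exact tendsto_one_div_atTop_nhds_zero_nat
    · refine (Complex.continuous_exp.tendsto _).comp (tendsto_const_nhds.mul ?_)
      refine (Complex.continuous_ofReal.tendsto _).comp ?_
      exact Real.tendsto_harmonic_sub_log.add tendsto_one_div_add_atTop_nhds_zero_nat
  have h3 := h2.congr' (by
    filter_upwards [eventually_ne_atTop 0] with N hN
    exact (hzG_partial s hs N hN).symm)
  simpa using tendsto_nhds_unique h1 h3

lemma hz_digamma (s : ℂ) (hs : 0 < s.re) :
    ∑' n : ℕ, (1 / ((n : ℂ) + 1) - 1 / ((n : ℂ) + s)) =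
      deriv Complex.Gamma s / Complex.Gamma s + Real.eulerMascheroniConstant := by
  have hd := (hzG_main s hs).1.cexp
  have hG : DifferentiableAt ℂ Complex.Gamma s := Complex.differentiableAt_Gamma s (by
    intro m h
    rw [h] at hs
    have : (0 : ℝ) ≤ m := Nat.cast_nonneg m
    simp at hs
    linarith)
  have hE : HasDerivAt (fun w : ℂ => Complex.exp ((w - 1) * (Real.eulerMascheroniConstant : ℂ)))
      (Complex.exp ((s - 1) * (Real.eulerMascheroniConstant : ℂ)) *
        (1 * (Real.eulerMascheroniConstant : ℂ))) s :=
    (((hasDerivAt_id s).sub_const 1).mul_const _).cexp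
  have hR := hG.hasDerivAt.mul hE
  have heq : (fun w => Complex.exp (∑' n, hzG n w)) =ᶠ[nhds s] (fun w => Complex.Gamma w *
      Complex.exp ((w - 1) * (Real.eulerMascheroniConstant : ℂ))) := by
    filter_upwards [(isOpen_lt continuous_const Complex.continuous_re).mem_nhds hs] with w hw
    exact hzG_exp w hw
  have := hd.unique (hR.congr_of_eventuallyEq heq)
  rw [hzG_exp s hs] at this
  have hG0 := Complex.Gamma_ne_zero_of_re_pos hs
  have hE0 := Complex.exp_ne_zero ((s - 1) * (Real.eulerMascheroniConstant : ℂ))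
  have h5 : Complex.Gamma s * (∑' n : ℕ, (1 / ((n : ℂ) + 1) - 1 / ((n : ℂ) + s))) =
      deriv Complex.Gamma s + Complex.Gamma s * Real.eulerMascheroniConstant := by
    apply mul_right_cancel₀ hE0
    linear_combination this
  generalize (∑' n : ℕ, (1 / ((n : ℂ) + 1) - 1 / ((n : ℂ) + s))) = T at h5 ⊢
  field_simp
  linear_combination h5

lemma hz_diff_bound {s : ℂ} {c : ℝ} (hc : 0 < c) (hc1 : c ≤ 1) (hcs : c ≤ s.re) {z : ℂ}
    (hz : 1 < z.re) (hz1 : ‖z - 1‖ < 1) (n : ℕ) :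
    ‖((n : ℂ) + s) ^ (-z) - ((n : ℂ) + 1) ^ (-z)‖ ≤
      (2 * (Real.exp Real.pi * (c ^ 3)⁻¹) * ‖s - 1‖) * (((n : ℝ) + 1) ^ 2)⁻¹ := by
  have hn : (0 : ℝ) < (n : ℝ) + 1 := by positivity
  have hn0 : (0 : ℝ) ≤ (n : ℝ) := by positivity
  have hzn : ‖z‖ ≤ 2 := by
    have := norm_add_le (z - 1) 1
    simp at this
    linarith
  have hre : z.re ≤ 2 := (Complex.re_le_norm z).trans hzn
  have him : |z.im| ≤ 1 := by
    have := Complex.abs_im_le_norm (z - 1)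
    simp at this
    linarith
  have hder : ∀ w ∈ {w : ℂ | (n : ℝ) + c ≤ w.re},
      HasDerivWithinAt (fun w : ℂ => w ^ (-z)) (-z * w ^ (-z - 1) * 1)
        {w : ℂ | (n : ℝ) + c ≤ w.re} w := by
    intro w hw
    have hw' : (n : ℝ) + c ≤ w.re := hw
    exact ((hasDerivAt_id w).cpow_const (Or.inl (by simp; linarith))).hasDerivWithinAt
  have hbd : ∀ w ∈ {w : ℂ | (n : ℝ) + c ≤ w.re},
      ‖-z * w ^ (-z - 1) * 1‖ ≤ 2 * (Real.exp Real.pi * (c ^ 3)⁻¹) * (((n : ℝ) + 1) ^ 2)⁻¹ := by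
    intro w hw
    have hl := hz_lower hc1 n hw
    have hp : 0 < c * ((n : ℝ) + 1) := by positivity
    have hw0 : w ≠ 0 := norm_pos_iff.1 (hp.trans_le hl)
    rw [mul_one, norm_mul, norm_neg, Complex.norm_cpow_of_ne_zero hw0]
    have h1 : ‖w‖ ^ (-z - 1).re ≤ (c ^ 3)⁻¹ * (((n : ℝ) + 1) ^ 2)⁻¹ := by
      have hexp : (-z - 1).re = -(z.re + 1) := by simp; ring
      rw [hexp]
      calc ‖w‖ ^ (-(z.re + 1)) ≤ (c * ((n : ℝ) + 1)) ^ (-(z.re + 1)) :=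
            Real.rpow_le_rpow_of_nonpos hp hl (by linarith)
        _ = c ^ (-(z.re + 1)) * ((n : ℝ) + 1) ^ (-(z.re + 1)) :=
            Real.mul_rpow hc.le hn.le
        _ ≤ c ^ (-(3 : ℝ)) * ((n : ℝ) + 1) ^ (-(2 : ℝ)) := by
            refine mul_le_mul ?_ ?_ (by positivity) (by positivity)
            · exact Real.rpow_le_rpow_of_exponent_ge hc hc1 (by linarith)
            · exact Real.rpow_le_rpow_of_exponent_le (by linarith) (by linarith)
        _ = _ := by
            rw [Real.rpow_neg hc.le, Real.rpow_neg hn.le]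
            norm_cast
    have h2 : (Real.exp (w.arg * (-z - 1).im))⁻¹ ≤ Real.exp Real.pi := by
      rw [← Real.exp_neg]
      apply Real.exp_le_exp.2
      have h3 : -(w.arg * (-z - 1).im) = w.arg * z.im := by simp
      rw [h3]
      calc w.arg * z.im ≤ |w.arg * z.im| := le_abs_self _
        _ = |w.arg| * |z.im| := abs_mul _ _
        _ ≤ Real.pi * 1 := mul_le_mul (Complex.abs_arg_le_pi w) him (abs_nonneg _) Real.pi_pos.le
        _ = Real.pi := mul_one _
    calc ‖z‖ * (‖w‖ ^ (-z - 1).re / Real.exp (w.arg * (-z - 1).im))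
        ≤ 2 * (((c ^ 3)⁻¹ * (((n : ℝ) + 1) ^ 2)⁻¹) * Real.exp Real.pi) := by
          rw [div_eq_mul_inv]
          gcongr
      _ = _ := by ring
  have := (convex_halfSpace_re_ge ((n : ℝ) + c)).norm_image_sub_le_of_norm_hasDerivWithin_le
    hder hbd (x := (n : ℂ) + 1) (y := (n : ℂ) + s) (by simpa using hc1) (by simpa using hcs)
  refine this.trans (le_of_eq ?_)
  rw [add_sub_add_left_eq_sub]
  ring

/-- The constant term of the Laurent expansion of the Hurwitz zeta function at
its pole `z = 1`: for `Re(s) > 0`, `ζ(z,s) − 1/(z−1) → −Γ'(s)/Γ(s)` as `z → 1`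
through the half-plane `Re(z) > 1`. -/
theorem hurwitzZeta_limit_at_one (s : ℂ) (hs : 0 < s.re) :
    Tendsto (fun z : ℂ => (∑' n : ℕ, ((n : ℂ) + s) ^ (-z)) - 1 / (z - 1))
      (nhdsWithin 1 {z : ℂ | 1 < z.re})
      (nhds (-(deriv Complex.Gamma s / Complex.Gamma s))) := by
  obtain ⟨c, hc, hc1, hcs⟩ : ∃ c : ℝ, 0 < c ∧ c ≤ 1 ∧ c ≤ s.re :=
    ⟨min 1 s.re, lt_min one_pos hs, min_le_left _ _, min_le_right _ _⟩
  have hev : ∀ᶠ z : ℂ in nhdsWithin 1 {z : ℂ | 1 < z.re}, 1 < z.re ∧ ‖z - 1‖ < 1 := by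
    refine Filter.Eventually.and self_mem_nhdsWithin (mem_nhdsWithin_of_mem_nhds ?_)
    filter_upwards [Metric.ball_mem_nhds (1 : ℂ) one_pos] with z hz
    rwa [Metric.mem_ball, dist_eq_norm] at hz
  have hne : ∀ {w : ℂ}, 0 < w.re → ∀ n : ℕ, (n : ℂ) + w ≠ 0 := by
    intro w hw n h
    have := congrArg Complex.re h
    have h2 : (0 : ℝ) ≤ n := Nat.cast_nonneg n
    simp at this
    linarith
  have hD : Tendsto (fun z : ℂ => ∑' n : ℕ, (((n : ℂ) + s) ^ (-z) - ((n : ℂ) + 1) ^ (-z)))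
      (nhdsWithin 1 {z : ℂ | 1 < z.re})
      (nhds (∑' n : ℕ, (((n : ℂ) + s) ^ (-1 : ℂ) - ((n : ℂ) + 1) ^ (-1 : ℂ)))) := by
    refine tendsto_tsum_of_dominated_convergence
      (hz_summable (2 * (Real.exp Real.pi * (c ^ 3)⁻¹) * ‖s - 1‖)) ?_ ?_
    · intro n
      refine Tendsto.mono_left ?_ nhdsWithin_le_nhds
      have key : ∀ a : ℂ, a ≠ 0 → Tendsto (fun z : ℂ => a ^ (-z)) (nhds 1) (nhds (a ^ (-1 : ℂ))) :=
        fun a ha => ((continuous_neg (G := ℂ)).const_cpow (Or.inl ha)).tendsto 1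
      exact (key _ (hne hs n)).sub (key _ (hne (by simp) n))
    · filter_upwards [hev] with z hz n
      exact hz_diff_bound hc hc1 hcs hz.1 hz.2 n
  have hZ : Tendsto (fun z : ℂ => riemannZeta z - 1 / (z - 1))
      (nhdsWithin 1 {z : ℂ | 1 < z.re}) (nhds (Real.eulerMascheroniConstant : ℂ)) := by
    refine tendsto_riemannZeta_sub_one_div.mono_left (nhdsWithin_mono _ ?_)
    intro z hz h
    have hz' : 1 < z.re := hz
    rw [Set.mem_singleton_iff.1 h] at hz'
    simp at hz'
  have hlim : (∑' n : ℕ, (((n : ℂ) + s) ^ (-1 : ℂ) - ((n : ℂ) + 1) ^ (-1 : ℂ))) +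
      (Real.eulerMascheroniConstant : ℂ) = -(deriv Complex.Gamma s / Complex.Gamma s) := by
    have h := hz_digamma s hs
    have h2 : (∑' n : ℕ, (((n : ℂ) + s) ^ (-1 : ℂ) - ((n : ℂ) + 1) ^ (-1 : ℂ))) =
        -∑' n : ℕ, (1 / ((n : ℂ) + 1) - 1 / ((n : ℂ) + s)) := by
      rw [← tsum_neg]
      congr 1
      funext n
      rw [Complex.cpow_neg_one, Complex.cpow_neg_one]
      ring
    rw [h2, h]
    ring
  rw [← hlim]
  refine (hD.add hZ).congr' ?_
  filter_upwards [hev] with z hz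
  have hsd : Summable (fun n : ℕ => ((n : ℂ) + s) ^ (-z) - ((n : ℂ) + 1) ^ (-z)) :=
    Summable.of_norm_bounded (hz_summable _) (hz_diff_bound hc hc1 hcs hz.1 hz.2)
  have hs1 : Summable (fun n : ℕ => ((n : ℂ) + 1) ^ (-z)) := by
    have h := (summable_nat_add_iff 1).2 (Complex.summable_one_div_nat_cpow.2 hz.1)
    refine h.congr fun n => ?_
    rw [Complex.cpow_neg]
    push_cast
    ring
  have hzeta : riemannZeta z = ∑' n : ℕ, ((n : ℂ) + 1) ^ (-z) := by
    rw [zeta_eq_tsum_one_div_nat_add_one_cpow hz.1]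
    congr 1
    funext n
    rw [Complex.cpow_neg, one_div]
  have hsum := hsd.tsum_add hs1
  simp only [sub_add_cancel] at hsum
  rw [hsum, hzeta]
  ring
end

section
/- For every integer n ≥ 1 and every real s > 0, Σ_{k≥0} (k+s)^{−(n+1)} = ((−1)^{n+1}/n!) · ψ^{(n)}(s), where ψ^{(n)}(s) denotes the (n+1)-st iterated derivative of the function u ↦ log Γ(u) at u = s (Γ being the real Gamma function, positive on (0, ∞)). In particular ζ(n+1, s) = (−1)^{n+1} ψ^{(n)}(s)/n! for the Hurwitz zeta function ζ(z, s) = Σ_{k≥0}(k+s)^{−z}. -/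
open Filter Topology Set

lemma hp_summable (m : ℕ) (hm : 2 ≤ m) (a : ℝ) (ha : 0 < a) :
    Summable (fun k : ℕ => (((k : ℝ) + a) ^ m)⁻¹) := by
  have h := (Real.summable_one_div_nat_add_rpow a (m : ℝ)).2 (by exact_mod_cast hm)
  refine h.congr fun k => ?_
  have : (0 : ℝ) < k + a := by positivity
  rw [abs_of_pos this, Real.rpow_natCast, one_div]

lemma hp_hasDerivAt_term (m k : ℕ) (x : ℝ) (hx : 0 < x) :
    HasDerivAt (fun y : ℝ => (((k : ℝ) + y) ^ m)⁻¹) (-(m : ℝ) * (((k : ℝ) + x) ^ (m + 1))⁻¹) x := by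
  have h0 : (0 : ℝ) < k + x := by positivity
  have h1 : HasDerivAt (fun y : ℝ => (k : ℝ) + y) 1 x := (hasDerivAt_id x).const_add _
  have h2 := (h1.pow m).inv (pow_ne_zero m h0.ne')
  have h3 : -(m : ℝ) * (((k : ℝ) + x) ^ (m + 1))⁻¹ =
      -((m : ℝ) * ((k : ℝ) + x) ^ (m - 1) * 1) / (((k : ℝ) + x) ^ m) ^ 2 := by
    rcases m with _ | m
    · simp
    · simp only [Nat.add_sub_cancel]
      field_simp
      ring
  rw [h3]
  exact h2

lemma hp_hasDerivAt_tsum (m : ℕ) (hm : 2 ≤ m) (x : ℝ) (hx : 0 < x) :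
    HasDerivAt (fun y : ℝ => ∑' k : ℕ, (((k : ℝ) + y) ^ m)⁻¹)
      (-(m : ℝ) * ∑' k : ℕ, (((k : ℝ) + x) ^ (m + 1))⁻¹) x := by
  rw [← tsum_mul_left]
  refine hasDerivAt_tsum_of_isPreconnected (t := Ioi (x / 2)) (y₀ := x)
    (u := fun k : ℕ => (m : ℝ) * (((k : ℝ) + x / 2) ^ (m + 1))⁻¹)
    ((hp_summable (m + 1) (by omega) (x / 2) (by positivity)).mul_left _)
    isOpen_Ioi isPreconnected_Ioi
    (fun k y hy => hp_hasDerivAt_term m k y (lt_trans (by positivity) hy)) ?_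
    (by simp [hx]) (hp_summable m hm x hx) (by simp [hx])
  intro k y hy
  have hy' : x / 2 < y := hy
  have : 0 < y := lt_trans (by positivity) hy
  rw [norm_mul, norm_neg, Real.norm_of_nonneg (by positivity : (0 : ℝ) ≤ m),
    Real.norm_of_nonneg (by positivity)]
  gcongr

lemma hp_hasDerivAt_first (x : ℝ) (hx : 0 < x) :
    HasDerivAt (fun y : ℝ => ∑' k : ℕ, (((k : ℝ) + 1)⁻¹ - ((k : ℝ) + y)⁻¹))
      (∑' k : ℕ, (((k : ℝ) + x) ^ 2)⁻¹) x ∧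
    Summable (fun k : ℕ => (((k : ℝ) + 1)⁻¹ - ((k : ℝ) + x)⁻¹)) := by
  set a := min x 1 / 2 with ha
  have ha0 : 0 < a := by positivity
  have hm : 0 < min x 1 := by positivity
  have hax : x ∈ Ioi a := by
    have := min_le_left x 1
    simp only [mem_Ioi]; linarith
  have ha1 : (1 : ℝ) ∈ Ioi a := by
    have := min_le_right x 1
    simp only [mem_Ioi]; linarith
  have hd : ∀ (k : ℕ) (y : ℝ), y ∈ Ioi a →
      HasDerivAt (fun y : ℝ => (((k : ℝ) + 1)⁻¹ - ((k : ℝ) + y)⁻¹)) ((((k : ℝ) + y) ^ 2)⁻¹) y := by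
    intro k y hy
    have := (hp_hasDerivAt_term 1 k y (lt_trans ha0 hy)).const_sub (((k : ℝ) + 1)⁻¹)
    simpa using this
  have hb : ∀ (k : ℕ) (y : ℝ), y ∈ Ioi a →
      ‖(((k : ℝ) + y) ^ 2)⁻¹‖ ≤ (((k : ℝ) + a) ^ 2)⁻¹ := by
    intro k y hy
    have hy' : a < y := hy
    rw [Real.norm_of_nonneg (by positivity)]
    gcongr
  have hs1 : Summable (fun k : ℕ => (((k : ℝ) + 1)⁻¹ - ((k : ℝ) + 1)⁻¹)) := by
    simp only [sub_self]; exact summable_zero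
  exact ⟨hasDerivAt_tsum_of_isPreconnected (hp_summable 2 le_rfl a ha0) isOpen_Ioi
    isPreconnected_Ioi hd hb ha1 hs1 hax,
    summable_of_summable_hasDerivAt_of_isPreconnected (hp_summable 2 le_rfl a ha0) isOpen_Ioi
    isPreconnected_Ioi hd hb ha1 hs1 hax⟩

lemma lg_diff (x : ℝ) (hx : 0 < x) :
    DifferentiableAt ℝ (fun u : ℝ => Real.log (Real.Gamma u)) x :=
  (Real.differentiableAt_Gamma (fun m => by
    have : (0 : ℝ) ≤ m := by positivity
    linarith)).log (Real.Gamma_pos_of_pos hx).ne'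

lemma lg_deriv_add_one (x : ℝ) (hx : 0 < x) :
    deriv (fun u : ℝ => Real.log (Real.Gamma u)) (x + 1) =
      deriv (fun u : ℝ => Real.log (Real.Gamma u)) x + x⁻¹ := by
  have h1 : (fun u : ℝ => Real.log (Real.Gamma (u + 1))) =ᶠ[𝓝 x]
      fun u => Real.log (Real.Gamma u) + Real.log u := by
    filter_upwards [Ioi_mem_nhds hx] with u hu
    have hu' : 0 < u := hu
    rw [Real.Gamma_add_one hu'.ne', Real.log_mul hu'.ne' (Real.Gamma_pos_of_pos hu').ne', add_comm]
  have h2 := h1.deriv_eq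
  rw [deriv_comp_add_const (f := fun u : ℝ => Real.log (Real.Gamma u))] at h2
  rw [h2, deriv_fun_add (lg_diff x hx) (Real.differentiableAt_log hx.ne'), Real.deriv_log]

lemma lg_deriv_add_nat (x : ℝ) (hx : 0 < x) (N : ℕ) :
    deriv (fun u : ℝ => Real.log (Real.Gamma u)) (x + N) =
      deriv (fun u : ℝ => Real.log (Real.Gamma u)) x + ∑ k ∈ Finset.range N, ((k : ℝ) + x)⁻¹ := by
  induction N with
  | zero => simp
  | succ N ih =>
    have := lg_deriv_add_one (x + N) (by positivity)
    rw [Finset.sum_range_succ, ← add_assoc, ← ih]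
    push_cast
    rw [← add_assoc, this, add_comm x (N : ℝ)]

lemma lg_mono : MonotoneOn (deriv (fun u : ℝ => Real.log (Real.Gamma u))) (Ioi 0) :=
  Real.convexOn_log_Gamma.monotoneOn_deriv (fun x hx => lg_diff x hx)

/-- Along the natural numbers, the increments of the digamma function tend to zero. -/
lemma lg_tendsto_nat (x : ℝ) (hx : 0 < x) (M : ℕ) :
    Tendsto (fun N : ℕ => deriv (fun u : ℝ => Real.log (Real.Gamma u)) (x + N + M) -
      deriv (fun u : ℝ => Real.log (Real.Gamma u)) (x + N)) atTop (𝓝 0) := by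
  have h : ∀ N : ℕ, deriv (fun u : ℝ => Real.log (Real.Gamma u)) (x + N + M) -
      deriv (fun u : ℝ => Real.log (Real.Gamma u)) (x + N) =
      ∑ k ∈ Finset.range M, ((k : ℝ) + (x + N))⁻¹ := fun N => by
    rw [lg_deriv_add_nat (x + N) (by positivity) M]; ring
  simp only [h]
  rw [← Finset.sum_const_zero (s := Finset.range M)]
  refine tendsto_finsetSum _ fun k _ => tendsto_inv_atTop_zero.comp ?_
  exact tendsto_atTop_add_const_left _ _ (tendsto_atTop_add_const_left _ _
    tendsto_natCast_atTop_atTop)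

lemma lg_tendsto (x y : ℝ) (hx : 0 < x) (hxy : x ≤ y) :
    Tendsto (fun N : ℕ => deriv (fun u : ℝ => Real.log (Real.Gamma u)) (y + N) -
      deriv (fun u : ℝ => Real.log (Real.Gamma u)) (x + N)) atTop (𝓝 0) := by
  obtain ⟨M, hM⟩ := exists_nat_ge (y - x)
  refine squeeze_zero (fun N => ?_) (fun N => ?_) (lg_tendsto_nat x hx M)
  · have hN : (0 : ℝ) ≤ N := by positivity
    exact sub_nonneg.2 (lg_mono (mem_Ioi.2 (by linarith)) (mem_Ioi.2 (by linarith)) (by linarith))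
  · have hN : (0 : ℝ) ≤ N := by positivity
    exact sub_le_sub_right (lg_mono (mem_Ioi.2 (by linarith)) (mem_Ioi.2 (by linarith))
      (by linarith)) _

lemma lg_tendsto_one (x : ℝ) (hx : 0 < x) :
    Tendsto (fun N : ℕ => deriv (fun u : ℝ => Real.log (Real.Gamma u)) (x + N) -
      deriv (fun u : ℝ => Real.log (Real.Gamma u)) (1 + N)) atTop (𝓝 0) := by
  rcases le_total 1 x with h | h
  · exact lg_tendsto 1 x one_pos h
  · simpa using (lg_tendsto x 1 hx h).neg

/-- Series for the digamma function. -/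
lemma lg_series (x : ℝ) (hx : 0 < x) :
    deriv (fun u : ℝ => Real.log (Real.Gamma u)) x =
      deriv (fun u : ℝ => Real.log (Real.Gamma u)) 1 +
        ∑' k : ℕ, (((k : ℝ) + 1)⁻¹ - ((k : ℝ) + x)⁻¹) := by
  have h1 := (hp_hasDerivAt_first x hx).2.hasSum.tendsto_sum_nat
  have h2 := h1.add (lg_tendsto_one x hx)
  have h3 : ∀ N : ℕ, ∑ k ∈ Finset.range N, (((k : ℝ) + 1)⁻¹ - ((k : ℝ) + x)⁻¹) +
      (deriv (fun u : ℝ => Real.log (Real.Gamma u)) (x + N) -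
      deriv (fun u : ℝ => Real.log (Real.Gamma u)) (1 + N)) =
      deriv (fun u : ℝ => Real.log (Real.Gamma u)) x -
      deriv (fun u : ℝ => Real.log (Real.Gamma u)) 1 := fun N => by
    rw [lg_deriv_add_nat x hx, lg_deriv_add_nat 1 one_pos, Finset.sum_sub_distrib]; ring
  simp only [h3] at h2
  have := tendsto_nhds_unique h2 tendsto_const_nhds
  linarith

lemma lg_iterated (n : ℕ) : ∀ s : ℝ, 0 < s →
    iteratedDeriv (n + 2) (fun u : ℝ => Real.log (Real.Gamma u)) s =
      (-1 : ℝ) ^ n * ((n + 1).factorial : ℝ) * ∑' k : ℕ, (((k : ℝ) + s) ^ (n + 2))⁻¹ := by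
  induction n with
  | zero =>
    intro s hs
    rw [iteratedDeriv_succ, iteratedDeriv_one]
    have h : deriv (fun u : ℝ => Real.log (Real.Gamma u)) =ᶠ[𝓝 s] fun x =>
        deriv (fun u : ℝ => Real.log (Real.Gamma u)) 1 +
        ∑' k : ℕ, (((k : ℝ) + 1)⁻¹ - ((k : ℝ) + x)⁻¹) := by
      filter_upwards [Ioi_mem_nhds hs] with u hu using lg_series u hu
    rw [h.deriv_eq, ((hp_hasDerivAt_first s hs).1.const_add _).deriv]
    simp
  | succ n ih =>
    intro s hs
    rw [iteratedDeriv_succ]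
    have h : iteratedDeriv (n + 2) (fun u : ℝ => Real.log (Real.Gamma u)) =ᶠ[𝓝 s] fun x =>
        (-1 : ℝ) ^ n * ((n + 1).factorial : ℝ) * ∑' k : ℕ, (((k : ℝ) + x) ^ (n + 2))⁻¹ := by
      filter_upwards [Ioi_mem_nhds hs] with u hu using ih u hu
    rw [show n + 1 + 1 = n + 2 from rfl, h.deriv_eq,
      ((hp_hasDerivAt_tsum (n + 2) (by omega) s hs).const_mul _).deriv,
      Nat.factorial_succ (n + 1)]
    push_cast
    rw [show n + 1 + 2 = n + 2 + 1 by ring]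
    ring


/-- `ζ(n+1, s) = (−1)^{n+1} ψ^{(n)}(s)/n!` for `n ≥ 1` and real `s > 0`, where
`ψ^{(n)}(s) = (d/ds)^{n+1} log Γ(s)` is the polygamma function. -/
theorem hurwitzZeta_eq_polygamma (n : ℕ) (hn : 1 ≤ n) (s : ℝ) (hs : 0 < s) :
    HasSum (fun k : ℕ => ((k : ℝ) + s) ^ (-((n : ℤ) + 1)))
      (((-1 : ℝ) ^ (n + 1) / (n.factorial : ℝ)) *
        iteratedDeriv (n + 1) (fun u : ℝ => Real.log (Real.Gamma u)) s) := by

  obtain ⟨m, rfl⟩ : ∃ m, n = m + 1 := ⟨n - 1, by omega⟩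
  rw [show m + 1 + 1 = m + 2 from rfl, lg_iterated m s hs]
  have hf : ((m + 1).factorial : ℝ) ≠ 0 := by positivity
  have h1 : (-1 : ℝ) ^ m * (-1) ^ m = 1 := by rw [← mul_pow]; simp
  have h2 : ((-1 : ℝ) ^ (m + 2) / ((m + 1).factorial : ℝ)) * ((-1 : ℝ) ^ m *
      ((m + 1).factorial : ℝ) * ∑' k : ℕ, (((k : ℝ) + s) ^ (m + 2))⁻¹) =
      ∑' k : ℕ, (((k : ℝ) + s) ^ (m + 2))⁻¹ := by
    generalize (∑' k : ℕ, (((k : ℝ) + s) ^ (m + 2))⁻¹) = T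
    rw [pow_add]
    field_simp
    linear_combination T * h1
  rw [h2]
  convert (hp_summable (m + 2) (by omega) s hs).hasSum using 2 with k
  rw [zpow_neg]
  congr 1
end
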